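/- There is an absolute constant C > 0 such that the following holds (weak decoupling). Let f be a homogeneous polynomial of degree d in n real variables with multilinear components {f_{2α}}. Then for every multi-index α with |α| ≤ d/2 and every unit vector y ∈ ℝⁿ, ‖f‖₂ ≥ y^{2α} · ‖f_{2α}‖₂ · C^{−d}. -/

import Mathlib

open MvPolynomial

/-- `‖f‖₂ = sup_{‖x‖₂ = 1} |f(x)|` for a polynomial `f` in `n` real variables. -/
noncomputable def sphereNorm {n : ℕ} (f : MvPolynomial (Fin n) ℝ) : ℝ :=
  sSup {y | ∃ x : Fin n → ℝ, (∑ i, x i ^ 2) = 1 ∧ y = |eval x f|}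


/-- A polynomial is multilinear if every variable appears with degree at most 1
in every monomial with nonzero coefficient. -/
def IsMultilinear {n : ℕ} (p : MvPolynomial (Fin n) ℝ) : Prop :=
  ∀ m ∈ p.support, ∀ i, m i ≤ 1

/-- `|α| = Σᵢ αᵢ`, the total degree of the multi-index `α`. -/
def mdeg {n : ℕ} (α : Fin n →₀ ℕ) : ℕ := α.sum fun _ e => e

/-- `g` is the multilinear decomposition of the degree-`d` homogeneous polynomial `f`,
i.e. `f = Σ_{|α| ≤ d/2} g α · x^{2α}` where each `g α` is multilinear and homogeneous
of degree `d - 2|α|`. -/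
def IsMLDecomp {n : ℕ} (d : ℕ) (f : MvPolynomial (Fin n) ℝ)
    (g : (Fin n →₀ ℕ) → MvPolynomial (Fin n) ℝ) : Prop :=
  (∀ α : Fin n →₀ ℕ,
      (mdeg α ≤ d / 2 → IsMultilinear (g α) ∧ (g α).IsHomogeneous (d - 2 * mdeg α)) ∧
      (d / 2 < mdeg α → g α = 0)) ∧
  f = ∑ᶠ α : Fin n →₀ ℕ, g α * monomial (2 • α) (1 : ℝ)

/-- `|𝒪(α)| = |α|! / ∏ᵢ αᵢ!`, the number of tuples corresponding to `α`. -/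
noncomputable def orbitCard {n : ℕ} (α : Fin n →₀ ℕ) : ℝ :=
  (Nat.factorial (mdeg α) : ℝ) / α.prod fun _ e => (Nat.factorial e : ℝ)

lemma wd_rootsum (N : ℕ) (hN : N ≠ 0) (k : ℤ) (hk : |k| < N) :
    ∑ j : Fin N, ((Complex.exp (2 * Real.pi * Complex.I / N)) ^ (j : ℕ)) ^ k
      = if k = 0 then (N : ℂ) else 0 := by
  set ω := Complex.exp (2 * Real.pi * Complex.I / N) with hω
  have hp : IsPrimitiveRoot ω N := Complex.isPrimitiveRoot_exp N hN
  split_ifs with h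
  · subst h; simp
  · have h1 : ω ^ k ≠ 1 := by
      intro h1
      have := (hp.zpow_eq_one_iff_dvd k).1 h1
      exact h (Int.eq_zero_of_abs_lt_dvd this hk)
    have h2 : (ω ^ k) ^ N = 1 := by
      rw [← zpow_natCast, ← zpow_mul, mul_comm, zpow_mul, zpow_natCast, hp.pow_eq_one, one_zpow]
    have h3 : ∀ j : ℕ, (ω ^ j) ^ k = (ω ^ k) ^ j := by
      intro j
      rw [← zpow_natCast, ← zpow_natCast, ← zpow_mul, ← zpow_mul, mul_comm]
    simp_rw [h3]
    rw [Fin.sum_univ_eq_sum_range (fun j => (ω ^ k) ^ j) N, geom_sum_eq h1, h2]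
    simp

lemma wd_coord (a d : ℕ) (h : 2 * a ≤ d) (x y : ℝ) :
    ∃ w z : Fin (d + 2) → ℂ, (∑ j, ‖w j‖ ≤ 1) ∧ (∀ j, ‖z j‖ ^ 2 ≤ 8 * (x ^ 2 + y ^ 2)) ∧
      ∀ k ≤ d, ∑ j, w j * z j ^ k =
        if k = 2 * a then (y : ℂ) ^ (2 * a) else if k = 2 * a + 1 then (y : ℂ) ^ (2 * a) * x else 0 := by
  set N := d + 2 with hNdef
  have hN : N ≠ 0 := by omega
  have hNC : (N : ℂ) ≠ 0 := by exact_mod_cast hN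
  obtain ⟨r, hr⟩ : ∃ r : ℝ, r = 2 * (|x| + |y|) := ⟨_, rfl⟩
  have hr0 : 0 ≤ r := by rw [hr]; positivity
  have hx : |x / r| ≤ 1 / 2 := by
    rw [abs_div, abs_of_nonneg hr0]
    apply div_le_of_le_mul₀ hr0 (by norm_num)
    rw [hr]; linarith [abs_nonneg y]
  have hy : |y / r| ≤ 1 / 2 := by
    rw [abs_div, abs_of_nonneg hr0]
    apply div_le_of_le_mul₀ hr0 (by norm_num)
    rw [hr]; linarith [abs_nonneg x]
  have hxr : x / r * r = x := by
    by_cases h0 : r = 0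
    · have : |x| = 0 := by linarith [abs_nonneg x, abs_nonneg y]
      simp [abs_eq_zero.1 this]
    · field_simp
  have hyr : y / r * r = y := by
    by_cases h0 : r = 0
    · have : |y| = 0 := by linarith [abs_nonneg x, abs_nonneg y]
      simp [abs_eq_zero.1 this]
    · field_simp
  obtain ⟨X, hX⟩ : ∃ X : ℝ, X = x / r := ⟨_, rfl⟩
  obtain ⟨Y, hY⟩ : ∃ Y : ℝ, Y = y / r := ⟨_, rfl⟩
  rw [← hX] at hx hxr
  rw [← hY] at hy hyr
  have hr2 : r ^ 2 ≤ 8 * (x ^ 2 + y ^ 2) := by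
    rw [hr, ← sq_abs x, ← sq_abs y]; nlinarith [sq_nonneg (|x| - |y|)]
  let ζ : Fin N → ℂ := fun j => (Complex.exp (2 * Real.pi * Complex.I / N)) ^ (j : ℕ)
  have hS : ∀ k : ℤ, |k| < N → ∑ j, ζ j ^ k = if k = 0 then (N : ℂ) else 0 :=
    fun k hk => wd_rootsum N hN k hk
  have hζ : ∀ j, ‖ζ j‖ = 1 := by
    intro j
    have hp := Complex.isPrimitiveRoot_exp N hN
    simp only [ζ, norm_pow]
    rw [Complex.norm_eq_one_of_pow_eq_one hp.pow_eq_one hN, one_pow]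
  have hζ0 : ∀ j, ζ j ≠ 0 := fun j h0 => by simpa [h0] using hζ j
  clear_value ζ
  have hzb : ∀ j, ‖(r : ℂ) * ζ j‖ ^ 2 ≤ 8 * (x ^ 2 + y ^ 2) := by
    intro j
    rw [norm_mul, hζ, mul_one, Complex.norm_real, Real.norm_eq_abs, sq_abs]; exact hr2
  rcases Nat.eq_zero_or_pos a with ha | ha
  · subst ha
    have key : ∀ k ≤ d, ∑ j, ((1 + X * (ζ j + (ζ j)⁻¹)) / N : ℂ) * (r * ζ j) ^ k =
        if k = 2 * 0 then (y : ℂ) ^ (2 * 0) else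
          if k = 2 * 0 + 1 then (y : ℂ) ^ (2 * 0) * x else 0 := by
      intro k hk
      have e : ∀ j, ((1 + X * (ζ j + (ζ j)⁻¹)) / N : ℂ) * (r * ζ j) ^ k =
          (r : ℂ) ^ k / N * (ζ j ^ (k : ℤ) + X * (ζ j ^ ((k : ℤ) + 1) + ζ j ^ ((k : ℤ) - 1))) := by
        intro j
        rw [zpow_add_one₀ (hζ0 j), zpow_sub_one₀ (hζ0 j), zpow_natCast, mul_pow]
        ring
      simp_rw [e]
      rw [← Finset.mul_sum, Finset.sum_add_distrib, ← Finset.mul_sum, Finset.sum_add_distrib,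
        hS k (by rw [abs_lt]; omega), hS (k + 1) (by rw [abs_lt]; omega),
        hS (k - 1) (by rw [abs_lt]; omega)]
      rcases k with _ | _ | k
      · simp [hNC]
      · rw [← hxr]; push_cast; simp; field_simp
      · have h1 : ((k + 1 + 1 : ℕ) : ℤ) ≠ 0 := by omega
        have h2 : ((k + 1 + 1 : ℕ) : ℤ) + 1 ≠ 0 := by omega
        have h3 : ((k + 1 + 1 : ℕ) : ℤ) - 1 ≠ 0 := by omega
        rw [if_neg h1, if_neg h2, if_neg h3, if_neg (by omega), if_neg (by omega)]; simp
    refine ⟨fun j => (1 + X * (ζ j + (ζ j)⁻¹)) / N, fun j => r * ζ j, ?_, hzb, key⟩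
    have k0 := key 0 (Nat.zero_le _)
    simp only [pow_zero, mul_one, mul_zero, if_true] at k0
    have e : ∀ j, ‖((1 + X * (ζ j + (ζ j)⁻¹)) / N : ℂ)‖ = ((1 + X * (ζ j + (ζ j)⁻¹)) / N : ℂ).re := by
      intro j
      have h1 : ((1 + X * (ζ j + (ζ j)⁻¹)) / N : ℂ) = (((1 + X * (2 * (ζ j).re)) / N : ℝ) : ℂ) := by
        rw [Complex.inv_eq_conj (hζ j), Complex.add_conj]; push_cast; ring
      have h2 : 0 ≤ (1 + X * (2 * (ζ j).re)) / N := by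
        have h3 : |(ζ j).re| ≤ 1 := (Complex.abs_re_le_norm _).trans (hζ j).le
        have h4 : |X * (2 * (ζ j).re)| ≤ 1 := by
          rw [abs_mul, abs_mul, abs_two]; nlinarith [abs_nonneg X, abs_nonneg (ζ j).re]
        have := (abs_le.1 h4).1
        apply div_nonneg (by linarith) (Nat.cast_nonneg _)
      rw [h1, Complex.norm_real, Complex.ofReal_re, Real.norm_eq_abs, abs_of_nonneg h2]
    simp_rw [e]
    rw [← Complex.re_sum, k0]; simp
  · refine ⟨fun j => Y ^ (2 * a) / N * (ζ j ^ (-(2 * a : ℤ)) * (1 + X * (ζ j)⁻¹)), fun j => r * ζ j,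
      ?_, hzb, ?_⟩
    · have : ∀ j ∈ Finset.univ, ‖(Y ^ (2 * a) / N * (ζ j ^ (-(2 * a : ℤ)) * (1 + X * (ζ j)⁻¹)) : ℂ)‖
          ≤ 1 / N := by
        intro j _
        rw [norm_mul, norm_mul, norm_div, norm_zpow, hζ, one_zpow, one_mul, norm_pow,
          Complex.norm_real, Real.norm_eq_abs, Complex.norm_natCast]
        have h1 : ‖(1 + X * (ζ j)⁻¹ : ℂ)‖ ≤ 2 := by
          refine (norm_add_le _ _).trans ?_
          rw [norm_mul, norm_inv, hζ, Complex.norm_real, Real.norm_eq_abs]; norm_num; linarith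
        have h2 : |Y| ^ (2 * a) ≤ 1 / 2 := by
          calc |Y| ^ (2 * a) ≤ |Y| ^ 1 :=
                pow_le_pow_of_le_one (abs_nonneg _) (by linarith) (by omega)
            _ ≤ _ := by simpa using hy
        have hNp : (0 : ℝ) < N := by positivity
        calc _ ≤ (1 / 2) / (N : ℝ) * 2 := by gcongr
          _ = 1 / N := by ring
      refine (Finset.sum_le_sum this).trans ?_
      have hNR : (N : ℝ) ≠ 0 := by exact_mod_cast hN
      simp [hNR]
    · intro k hk
      have e : ∀ j, (Y ^ (2 * a) / N * (ζ j ^ (-(2 * a : ℤ)) * (1 + X * (ζ j)⁻¹)) : ℂ) * (r * ζ j) ^ k =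
          (r : ℂ) ^ k * Y ^ (2 * a) / N * (ζ j ^ ((k : ℤ) - 2 * a) + X * (ζ j ^ ((k : ℤ) - 2 * a - 1))) := by
        intro j
        rw [zpow_sub_one₀ (hζ0 j), sub_eq_add_neg, zpow_add₀ (hζ0 j), zpow_natCast, mul_pow]
        ring
      simp_rw [e]
      rw [← Finset.mul_sum, Finset.sum_add_distrib, ← Finset.mul_sum,
        hS (k - 2 * a) (by rw [abs_lt]; omega), hS (k - 2 * a - 1) (by rw [abs_lt]; omega)]
      rw [← hyr, ← hxr]
      by_cases h1 : k = 2 * a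
      · have h2 : (k : ℤ) - 2 * a = 0 := by omega
        rw [h2, h1]; push_cast; simp; field_simp; ring
      · have h2 : (k : ℤ) - 2 * a ≠ 0 := by omega
        by_cases h3 : k = 2 * a + 1
        · have h4 : (k : ℤ) - 2 * a - 1 = 0 := by omega
          rw [if_neg h1, if_neg h2, if_pos h4, if_pos h3, h3]; push_cast; field_simp; ring
        · have h4 : (k : ℤ) - 2 * a - 1 ≠ 0 := by omega
          rw [if_neg h1, if_neg h2, if_neg h4, if_neg h3]; simp

lemma wd_hom {n d : ℕ} {f : MvPolynomial (Fin n) ℝ} (hf : f.IsHomogeneous d)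
    {A : Type*} [CommRing A] [Algebra ℝ A] (c : A) (z : Fin n → A) :
    aeval (fun i => c * z i) f = c ^ d * aeval z f := by
  rw [aeval_def, aeval_def, eval₂_eq', eval₂_eq', Finset.mul_sum]
  refine Finset.sum_congr rfl fun m hm => ?_
  have h := hf (mem_support_iff.1 hm)
  have h2 : ∑ i, m i = d := by
    rw [← h, Finsupp.weight_apply, Finsupp.sum_fintype _ _ (by simp)]; simp
  simp_rw [mul_pow]
  rw [Finset.prod_mul_distrib, Finset.prod_pow_eq_pow_sum, h2]
  ring

lemma wd_bdd {n : ℕ} (f : MvPolynomial (Fin n) ℝ) :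
    BddAbove {y | ∃ x : Fin n → ℝ, (∑ i, x i ^ 2) = 1 ∧ y = |eval x f|} := by
  have hc : IsCompact {x : Fin n → ℝ | (∑ i, x i ^ 2) = 1} := by
    apply Metric.isCompact_of_isClosed_isBounded
    · exact isClosed_eq (by fun_prop) continuous_const
    · rw [isBounded_iff_forall_norm_le]
      refine ⟨1, fun x hx => ?_⟩
      rw [pi_norm_le_iff_of_nonneg zero_le_one]
      intro i
      have : x i ^ 2 ≤ 1 := by
        rw [← (show _ = (1 : ℝ) from hx)]
        exact Finset.single_le_sum (f := fun i => x i ^ 2) (fun i _ => sq_nonneg _) (Finset.mem_univ i)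
      rw [Real.norm_eq_abs]
      exact (sq_le_one_iff_abs_le_one _).1 this
  have h := (hc.image (f := fun x => |eval x f|) (MvPolynomial.continuous_eval f).abs).bddAbove
  refine h.mono ?_
  rintro y ⟨x, hx, rfl⟩
  exact ⟨x, hx, rfl⟩

lemma wd_nonneg {n : ℕ} (f : MvPolynomial (Fin n) ℝ) : 0 ≤ sphereNorm f := by
  apply Real.sSup_nonneg
  rintro y ⟨x, hx, rfl⟩
  exact abs_nonneg _

lemma wd_real {n d : ℕ} {f : MvPolynomial (Fin n) ℝ} (hf : f.IsHomogeneous d)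
    (y : Fin n → ℝ) (hy : ∑ i, y i ^ 2 = 1) (p : Fin n → ℝ) (R : ℝ) (hR : 0 ≤ R)
    (hp : ∑ i, p i ^ 2 ≤ R ^ 2) : |eval p f| ≤ R ^ d * sphereNorm f := by
  obtain ⟨s, hs⟩ : ∃ s : ℝ, s = Real.sqrt (∑ i, p i ^ 2) := ⟨_, rfl⟩
  have hs0 : 0 ≤ s := by rw [hs]; positivity
  have hnn : 0 ≤ ∑ i, p i ^ 2 := Finset.sum_nonneg fun i _ => sq_nonneg _
  have hs2 : s ^ 2 = ∑ i, p i ^ 2 := by rw [hs, Real.sq_sqrt hnn]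
  have hsR : s ≤ R := by rw [hs]; exact Real.sqrt_le_iff.2 ⟨hR, hp⟩
  obtain ⟨e, he, hpe⟩ : ∃ e : Fin n → ℝ, ∑ i, e i ^ 2 = 1 ∧ p = fun i => s * e i := by
    by_cases h0 : s = 0
    · refine ⟨y, hy, ?_⟩
      rw [h0] at hs2
      funext i
      have := (Finset.sum_eq_zero_iff_of_nonneg (fun i _ => sq_nonneg (p i))).1
        (by rw [← hs2]; norm_num) i (Finset.mem_univ i)
      rw [h0, zero_mul]; exact pow_eq_zero_iff (two_ne_zero) |>.1 this
    · refine ⟨fun i => p i / s, ?_, ?_⟩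
      · simp_rw [div_pow]; rw [← Finset.sum_div, ← hs2]; field_simp
      · funext i; field_simp
  have h1 : eval p f = s ^ d * eval e f := by
    have := wd_hom hf s e
    rw [hpe]; simpa [MvPolynomial.aeval_eq_eval] using this
  have h2 : |eval e f| ≤ sphereNorm f := le_csSup (wd_bdd f) ⟨e, he, rfl⟩
  rw [h1, abs_mul, abs_of_nonneg (pow_nonneg hs0 d)]
  gcongr

lemma wd_complex {n d : ℕ} {f : MvPolynomial (Fin n) ℝ} (hf : f.IsHomogeneous d)
    (y : Fin n → ℝ) (hy : ∑ i, y i ^ 2 = 1) (z : Fin n → ℂ) (R : ℝ) (hR : 0 ≤ R)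
    (hz : ∑ i, ‖z i‖ ^ 2 ≤ R ^ 2) : ‖aeval z f‖ ≤ (2 * R) ^ d * sphereNorm f := by
  let q : ℂ → ℂ := fun t => aeval (fun i => z i + t * starRingEnd ℂ (z i)) f
  have hq : Differentiable ℂ q := by
    simp only [q]
    simp_rw [aeval_def, eval₂_eq']
    fun_prop
  have hb : ∀ t ∈ frontier (Metric.ball (0 : ℂ) 1), ‖q t‖ ≤ (2 * R) ^ d * sphereNorm f := by
    intro t ht
    rw [frontier_ball _ one_ne_zero] at ht
    have ht1 : ‖t‖ = 1 := by simpa using ht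
    obtain ⟨c, hc⟩ := IsAlgClosed.exists_pow_nat_eq t (n := 2) (by norm_num)
    have hc1 : ‖c‖ = 1 := by
      have : ‖c‖ ^ 2 = 1 := by rw [← norm_pow, hc, ht1]
      exact (pow_eq_one_iff_of_nonneg (norm_nonneg _) two_ne_zero).1 this
    have hcc : c * starRingEnd ℂ c = 1 := by
      rw [Complex.mul_conj, Complex.normSq_eq_norm_sq, hc1]; simp
    let p : Fin n → ℝ := fun i => 2 * (starRingEnd ℂ c * z i).re
    have e : (fun i => z i + t * starRingEnd ℂ (z i)) = fun i => c * ((p i : ℝ) : ℂ) := by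
      funext i
      have : ((p i : ℝ) : ℂ) = starRingEnd ℂ c * z i + c * starRingEnd ℂ (z i) := by
        have h := Complex.add_conj (starRingEnd ℂ c * z i)
        simp only [p]
        rw [← h]; simp
      rw [this, ← hc]
      linear_combination (-(z i)) * hcc
    have e2 : aeval (fun i => ((p i : ℝ) : ℂ)) f = ((eval p f : ℝ) : ℂ) := by
      rw [aeval_def, eval₂_eq', eval_eq']; simp
    simp only [q]
    rw [e, wd_hom hf, norm_mul, norm_pow, hc1, one_pow, one_mul, e2, Complex.norm_real,
      Real.norm_eq_abs]
    apply wd_real hf y hy p _ (by positivity)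
    calc ∑ i, p i ^ 2 ≤ ∑ i, 4 * ‖z i‖ ^ 2 := by
          refine Finset.sum_le_sum fun i _ => ?_
          have h1 : |(starRingEnd ℂ c * z i).re| ≤ ‖z i‖ := by
            refine (Complex.abs_re_le_norm _).trans ?_
            rw [norm_mul, RCLike.norm_conj, hc1, one_mul]
          have h2 := sq_le_sq' (by linarith [abs_nonneg (starRingEnd ℂ c * z i).re, norm_nonneg (z i)]) h1
          rw [sq_abs] at h2
          simp only [p]; rw [mul_pow]; linarith
      _ ≤ (2 * R) ^ 2 := by rw [← Finset.mul_sum, mul_pow]; linarith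
  have := Complex.norm_le_of_forall_mem_frontier_norm_le (U := Metric.ball (0 : ℂ) 1)
    Metric.isBounded_ball hq.diffContOnCl hb (z := 0) (subset_closure (by simp))
  simpa [q] using this

lemma wd_mdeg {n : ℕ} (α : Fin n →₀ ℕ) : mdeg α = ∑ i, α i := by
  rw [mdeg, Finsupp.sum_fintype _ _ (by simp)]

lemma wd_main {n d : ℕ} {f : MvPolynomial (Fin n) ℝ}
    {g : (Fin n →₀ ℕ) → MvPolynomial (Fin n) ℝ}
    (hf : f.IsHomogeneous d) (hg : IsMLDecomp d f g)
    (α : Fin n →₀ ℕ) (hα : mdeg α ≤ d / 2)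
    (y : Fin n → ℝ) (hy : ∑ i, y i ^ 2 = 1) (x : Fin n → ℝ) (hx : ∑ i, x i ^ 2 = 1) :
    (∏ i, y i ^ (2 * α i)) * |eval x (g α)| ≤ 8 ^ d * sphereNorm f := by
  have hαi : ∀ i, 2 * α i ≤ d := by
    intro i
    have : α i ≤ ∑ i, α i := Finset.single_le_sum (fun i _ => Nat.zero_le _) (Finset.mem_univ i)
    rw [wd_mdeg] at hα; omega
  choose w z hw hz hm using fun i => wd_coord (α i) d (hαi i) (x i) (y i)
  -- the functional
  let L : MvPolynomial (Fin n) ℝ →ₗ[ℝ] ℂ :=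
    ∑ p : Fin n → Fin (d + 2), (∏ i, w i (p i)) • (aeval (R := ℝ) (fun i => z i (p i))).toLinearMap
  have hL : ∀ h, L h = ∑ p : Fin n → Fin (d + 2), (∏ i, w i (p i)) * aeval (fun i => z i (p i)) h := by
    intro h
    simp [L, LinearMap.sum_apply]
  have hLm : ∀ (m : Fin n →₀ ℕ) (c : ℝ), L (monomial m c) = c * ∏ i, ∑ j, w i j * z i j ^ m i := by
    intro m c
    rw [hL, Finset.prod_univ_sum, Finset.mul_sum, Fintype.piFinset_univ]
    refine Finset.sum_congr rfl fun p _ => ?_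
    rw [aeval_monomial, Finsupp.prod_fintype _ _ (by simp), Finset.prod_mul_distrib]
    simp; ring
  have hLb : ‖L f‖ ≤ 8 ^ d * sphereNorm f := by
    rw [hL]
    have h1 : ∀ p : Fin n → Fin (d + 2), ‖aeval (fun i => z i (p i)) f‖ ≤ 8 ^ d * sphereNorm f := by
      intro p
      have := wd_complex hf y hy (fun i => z i (p i)) 4 (by norm_num) (by
        calc _ ≤ ∑ i, 8 * (x i ^ 2 + y i ^ 2) := Finset.sum_le_sum fun i _ => hz i (p i)
          _ = 4 ^ 2 := by rw [← Finset.mul_sum, Finset.sum_add_distrib, hx, hy]; norm_num)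
      norm_num at this; exact this
    have hnn : 0 ≤ 8 ^ d * sphereNorm f := mul_nonneg (by positivity) (wd_nonneg f)
    calc _ ≤ ∑ p : Fin n → Fin (d + 2), (∏ i, ‖w i (p i)‖) * (8 ^ d * sphereNorm f) := by
          refine (norm_sum_le _ _).trans (Finset.sum_le_sum fun p _ => ?_)
          rw [norm_mul, norm_prod]
          exact mul_le_mul_of_nonneg_left (h1 p) (Finset.prod_nonneg fun i _ => norm_nonneg _)
      _ = (∏ i, ∑ j, ‖w i j‖) * (8 ^ d * sphereNorm f) := by
          rw [← Finset.sum_mul, Finset.prod_univ_sum, Fintype.piFinset_univ]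
      _ ≤ 1 * (8 ^ d * sphereNorm f) := by
          refine mul_le_mul_of_nonneg_right ?_ hnn
          exact Finset.prod_le_one (fun i _ => Finset.sum_nonneg fun j _ => norm_nonneg _)
            (fun i _ => hw i)
      _ = _ := one_mul _
  -- action on pieces
  have hmono : ∀ γ : Fin n →₀ ℕ, mdeg γ ≤ d / 2 → L (g γ * monomial (2 • γ) (1 : ℝ)) =
      if γ = α then (((∏ i, y i ^ (2 * α i)) * eval x (g α) : ℝ) : ℂ) else 0 := by
    intro γ hγ
    obtain ⟨hml, hhom⟩ := (hg.1 γ).1 hγ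
    have e : g γ * monomial (2 • γ) (1 : ℝ) =
        ∑ m ∈ (g γ).support, monomial (m + 2 • γ) (coeff m (g γ)) := by
      conv_lhs => rw [(g γ).as_sum]
      rw [Finset.sum_mul]
      simp [monomial_mul]
    rw [e, map_sum]
    have hterm : ∀ m ∈ (g γ).support, L (monomial (m + 2 • γ) (coeff m (g γ))) =
        if γ = α then (((∏ i, y i ^ (2 * α i)) * (coeff m (g γ) * ∏ i, x i ^ m i) : ℝ) : ℂ)
          else 0 := by
      intro m hmem
      have h1 := hml m hmem
      have hdeg : ∑ i, m i = d - 2 * mdeg γ := by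
        rw [← hhom (mem_support_iff.1 hmem), Finsupp.weight_apply,
          Finsupp.sum_fintype _ _ (by simp)]; simp
      have hle : ∀ i, m i + 2 * γ i ≤ d := by
        intro i
        have a1 : m i ≤ ∑ i, m i :=
          Finset.single_le_sum (fun i _ => Nat.zero_le _) (Finset.mem_univ i)
        have a2 : γ i ≤ ∑ i, γ i :=
          Finset.single_le_sum (fun i _ => Nat.zero_le _) (Finset.mem_univ i)
        rw [← wd_mdeg] at a2; omega
      rw [hLm]
      have h2 : ∀ i, ∑ j, w i j * z i j ^ (m + 2 • γ) i =
          if γ i = α i then (y i : ℂ) ^ (2 * α i) * (x i : ℂ) ^ m i else 0 := by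
        intro i
        have e1 : (m + 2 • γ) i = m i + 2 * γ i := by simp
        rw [e1, hm i _ (hle i)]
        have := h1 i
        by_cases hh : γ i = α i
        · rw [if_pos hh, hh]
          have : m i = 0 ∨ m i = 1 := by omega
          rcases this with h3 | h3
          · simp [h3]
          · rw [h3, if_neg (by omega), if_pos (by omega), pow_one]
        · rw [if_neg hh, if_neg (by omega), if_neg (by omega)]
      simp_rw [h2]
      split_ifs with hh
      · subst hh
        simp only [if_true]
        rw [Finset.prod_mul_distrib]; push_cast; ring
      · obtain ⟨i, hi⟩ : ∃ i, γ i ≠ α i := by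
          by_contra hcon; push Not at hcon; exact hh (Finsupp.ext hcon)
        rw [Finset.prod_eq_zero (Finset.mem_univ i) (if_neg hi), mul_zero]
    rw [Finset.sum_congr rfl hterm]
    split_ifs with hh
    · subst hh
      rw [eval_eq', Finset.mul_sum]; push_cast; rfl
    · simp
  have hLf : L f = (((∏ i, y i ^ (2 * α i)) * eval x (g α) : ℝ) : ℂ) := by
    have hfin : {γ : Fin n →₀ ℕ | mdeg γ ≤ d / 2}.Finite := by
      refine (Finsupp.finite_of_degree_le (σ := Fin n) (d / 2)).subset ?_
      intro γ hγ
      simpa [Finsupp.degree_eq_sum, ← wd_mdeg] using hγ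
    rw [hg.2, finsum_eq_sum_of_support_subset (s := hfin.toFinset), map_sum]
    · rw [Finset.sum_congr rfl (fun γ hγ => hmono γ (by simpa using hγ)),
        Finset.sum_ite_eq_of_mem' _ _ _ (by simpa using hα)]
    · intro γ hγ
      by_contra hcon
      apply hγ
      have : d / 2 < mdeg γ := by simpa using hcon
      simp [(hg.1 γ).2 this]
  rw [hLf, Complex.norm_real, Real.norm_eq_abs, abs_mul, abs_of_nonneg] at hLb
  · exact hLb
  · exact Finset.prod_nonneg fun i _ => by rw [pow_mul]; positivity

theorem stmt9 : ∃ C : ℝ, C > 0 ∧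
    ∀ (n d : ℕ) (f : MvPolynomial (Fin n) ℝ)
      (g : (Fin n →₀ ℕ) → MvPolynomial (Fin n) ℝ),
      f.IsHomogeneous d → IsMLDecomp d f g →
      ∀ α : Fin n →₀ ℕ, mdeg α ≤ d / 2 →
      ∀ y : Fin n → ℝ, (∑ i, y i ^ 2) = 1 →
        (∏ i, y i ^ (2 * α i)) * sphereNorm (g α) * (C ^ d)⁻¹ ≤ sphereNorm f := by
  refine ⟨8, by norm_num, ?_⟩
  intro n d f g hf hg α hα y hy
  have hP : 0 ≤ ∏ i, y i ^ (2 * α i) :=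
    Finset.prod_nonneg fun i _ => by rw [pow_mul]; positivity
  rw [← div_eq_mul_inv, div_le_iff₀ (by positivity), mul_comm (sphereNorm f)]
  rcases hP.eq_or_lt with h0 | h0
  · rw [← h0, zero_mul]
    exact mul_nonneg (by positivity) (wd_nonneg f)
  · rw [← le_div_iff₀' h0]
    unfold sphereNorm
    refine csSup_le ⟨|eval y (g α)|, y, hy, rfl⟩ ?_
    change ∀ b ∈ _, b ≤ 8 ^ d * sphereNorm f / _
    rintro _ ⟨x, hx, rfl⟩
    rw [le_div_iff₀' h0]
    exact wd_main hf hg α hα y hy x hx
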